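/- arXiv:2511.09024 — 2 statements merged into one kernel-verified Lean document; each statement's English description precedes it below -/
import Mathlib

section
/- Fix a dimension d ≥ 1. There exists a constant C > 0, depending only on d, with the following property. Let n ≥ 1 and N ≥ 1 be integers and let X₁, …, Xₙ be random vectors in ℝ^d on a common probability space such that: E[X_i] = 0 for all i; max_{i} ‖X_i‖_{ψ₂} ≤ ν < ∞; and for every subset of indices whose pairwise distances are at least N, the corresponding random vectors are jointly independent. Then ‖Σ_{i=1}^n X_i‖_{ψ₂} ≤ C √(nN) ν. -/
open MeasureTheory ProbabilityTheory

/-- The sub-gaussian (ψ₂) norm of a random variable `X` with respect to a given norm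
function `nrm`: `‖X‖_{ψ₂} = inf { t > 0 : E[exp(nrm(X)²/t²)] ≤ 2 }` (valued in `ℝ≥0∞`;
it is `∞` when no finite `t` works). -/
noncomputable def psi2 {Ω α : Type*} [MeasurableSpace Ω] (P : Measure Ω)
    (nrm : α → ℝ) (X : Ω → α) : ENNReal :=
  sInf {t : ENNReal | 0 < t ∧
    ∫⁻ ω, ENNReal.ofReal (Real.exp (nrm (X ω) ^ 2 / t.toReal ^ 2)) ∂P ≤ 2}

/-- Euclidean norm on `ℝ^d`. -/
noncomputable def euclNorm {d : ℕ} (v : Fin d → ℝ) : ℝ := Real.sqrt (∑ j, v j ^ 2)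

open scoped NNReal ENNReal

namespace LocalDep

lemma exp_le_add_exp_sq (x : ℝ) : Real.exp x ≤ x + Real.exp (x ^ 2) := by
  have h2 := Real.add_one_le_exp (x ^ 2)
  by_cases h : |x| ≤ 1
  · have h1 := (abs_le.1 (Real.abs_exp_sub_one_sub_id_le h)).2
    linarith
  · by_cases hx : 0 ≤ x
    · have : x ≤ x ^ 2 := by rw [abs_of_nonneg hx] at h; nlinarith
      have := Real.exp_le_exp.2 this
      linarith
    · rw [abs_of_neg (by linarith)] at h
      have : Real.exp x ≤ 1 := Real.exp_le_one_iff.2 (by linarith)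
      nlinarith

lemma exp_mul_le (p y : ℝ) (h0 : 0 ≤ p) (h1 : p ≤ 1) :
    Real.exp (p * y) ≤ (1 - p) + p * Real.exp y := by
  have := convexOn_exp.2 (Set.mem_univ (0 : ℝ)) (Set.mem_univ y) (sub_nonneg.2 h1) h0 (by ring)
  simpa using this

variable {Ω : Type*} {mΩ : MeasurableSpace Ω} {P : Measure Ω}

lemma integrable_exp_of_lintegral {X : Ω → ℝ} (hX : Measurable X)
    (h : ∫⁻ ω, ENNReal.ofReal (Real.exp (X ω)) ∂P ≤ 2) :
    Integrable (fun ω => Real.exp (X ω)) P ∧ ∫ ω, Real.exp (X ω) ∂P ≤ 2 := by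
  have hm : AEStronglyMeasurable (fun ω => Real.exp (X ω)) P :=
    (Real.measurable_exp.comp hX).aestronglyMeasurable
  have hnn : 0 ≤ᵐ[P] (fun ω => Real.exp (X ω)) := ae_of_all _ fun ω => (Real.exp_pos _).le
  refine ⟨⟨hm, ?_⟩, ?_⟩
  · rw [hasFiniteIntegral_iff_ofReal hnn]
    exact h.trans_lt (by simp)
  · rw [integral_eq_lintegral_of_nonneg_ae hnn hm]
    exact ENNReal.toReal_mono (by simp) h

lemma integrable_of_psi [IsProbabilityMeasure P] {X : Ω → ℝ} (hX : Measurable X) {ν : ℝ} (hν : 0 < ν)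
    (h : ∫⁻ ω, ENNReal.ofReal (Real.exp (X ω ^ 2 / ν ^ 2)) ∂P ≤ 2) : Integrable X P := by
  obtain ⟨hi, -⟩ := integrable_exp_of_lintegral (by fun_prop) h
  refine (hi.const_mul ν).mono' hX.aestronglyMeasurable (ae_of_all _ fun ω => ?_)
  have h1 := Real.add_one_le_exp (X ω ^ 2 / ν ^ 2)
  have h2 : |X ω / ν| ≤ Real.exp (X ω ^ 2 / ν ^ 2) := by
    rw [← div_pow, ← sq_abs] at h1 ⊢
    nlinarith [sq_nonneg (|X ω / ν| - 1)]
  rw [abs_div, abs_of_pos hν, div_le_iff₀ hν] at h2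
  rw [Real.norm_eq_abs]
  linarith

lemma subG_of_psi [IsProbabilityMeasure P] {X : Ω → ℝ} (hX : Measurable X) {ν : ℝ≥0} (hν : 0 < ν)
    (h0 : ∫ ω, X ω ∂P = 0)
    (h : ∫⁻ ω, ENNReal.ofReal (Real.exp (X ω ^ 2 / (ν : ℝ) ^ 2)) ∂P ≤ 2) :
    HasSubgaussianMGF X (2 * ν ^ 2) P := by
  have hν' : (0 : ℝ) < ν := hν
  obtain ⟨hi, hle⟩ := integrable_exp_of_lintegral (by fun_prop) h
  have hXi := integrable_of_psi hX hν' h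
  have bound1 : ∀ t ω, Real.exp (t * X ω) ≤
      Real.exp ((t * ν) ^ 2 / 2) * (1 / 2 + 1 / 2 * Real.exp (X ω ^ 2 / (ν : ℝ) ^ 2)) := by
    intro t ω
    have h1 := exp_mul_le (1 / 2) (X ω ^ 2 / (ν : ℝ) ^ 2) (by norm_num) (by norm_num)
    calc Real.exp (t * X ω)
        ≤ Real.exp ((t * ν) ^ 2 / 2 + 1 / 2 * (X ω ^ 2 / (ν : ℝ) ^ 2)) := by
          apply Real.exp_le_exp.2
          have e : t * X ω = (t * ν) * (X ω / ν) := by field_simp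
          rw [e, ← div_pow]
          nlinarith [sq_nonneg (t * ν - X ω / ν)]
      _ = Real.exp ((t * ν) ^ 2 / 2) * Real.exp (1 / 2 * (X ω ^ 2 / (ν : ℝ) ^ 2)) := Real.exp_add _ _
      _ ≤ _ := by
          apply mul_le_mul_of_nonneg_left _ (Real.exp_pos _).le
          linarith
  have hib : ∀ t : ℝ, Integrable (fun ω => Real.exp ((t * ν) ^ 2 / 2) *
      (1 / 2 + 1 / 2 * Real.exp (X ω ^ 2 / (ν : ℝ) ^ 2))) P := fun t =>
    ((integrable_const _).add (hi.const_mul _)).const_mul _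
  have hexp : ∀ t, Integrable (fun ω => Real.exp (t * X ω)) P := fun t => by
    refine (hib t).mono' (by fun_prop) (ae_of_all _ fun ω => ?_)
    rw [Real.norm_eq_abs, abs_of_pos (Real.exp_pos _)]
    exact bound1 t ω
  refine ⟨hexp, fun t => ?_⟩
  have e : ((2 * ν ^ 2 : ℝ≥0) : ℝ) * t ^ 2 / 2 = (t * ν) ^ 2 := by push_cast; ring
  rw [e, mgf]
  by_cases hl : (t * ν) ^ 2 ≤ 1
  · have hb : ∀ ω, Real.exp (t * X ω) ≤ t * X ω + ((1 - (t * ν) ^ 2) +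
        (t * ν) ^ 2 * Real.exp (X ω ^ 2 / (ν : ℝ) ^ 2)) := by
      intro ω
      have h1 := exp_le_add_exp_sq (t * X ω)
      have h2 := exp_mul_le ((t * ν) ^ 2) (X ω ^ 2 / (ν : ℝ) ^ 2) (sq_nonneg _) hl
      have e : (t * ν) ^ 2 * (X ω ^ 2 / (ν : ℝ) ^ 2) = (t * X ω) ^ 2 := by field_simp
      rw [e] at h2
      linarith
    have i1 : Integrable (fun ω => (1 - (t * ν) ^ 2) +
        (t * ν) ^ 2 * Real.exp (X ω ^ 2 / (ν : ℝ) ^ 2)) P :=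
      (integrable_const _).add (hi.const_mul _)
    calc ∫ ω, Real.exp (t * X ω) ∂P ≤ ∫ ω, (t * X ω + ((1 - (t * ν) ^ 2) +
        (t * ν) ^ 2 * Real.exp (X ω ^ 2 / (ν : ℝ) ^ 2))) ∂P :=
          integral_mono (hexp t) ((hXi.const_mul t).add i1) hb
      _ = (1 - (t * ν) ^ 2) + (t * ν) ^ 2 * ∫ ω, Real.exp (X ω ^ 2 / (ν : ℝ) ^ 2) ∂P := by
          rw [integral_add (hXi.const_mul t) i1, integral_add (integrable_const _) (hi.const_mul _),
            integral_const_mul, integral_const_mul, h0]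
          simp
      _ ≤ (t * ν) ^ 2 + 1 := by nlinarith [sq_nonneg (t * ν)]
      _ ≤ _ := Real.add_one_le_exp _
  · calc ∫ ω, Real.exp (t * X ω) ∂P ≤ ∫ ω, (Real.exp ((t * ν) ^ 2 / 2) *
      (1 / 2 + 1 / 2 * Real.exp (X ω ^ 2 / (ν : ℝ) ^ 2))) ∂P :=
          integral_mono (hexp t) (hib t) (bound1 t)
      _ = Real.exp ((t * ν) ^ 2 / 2) *
          (1 / 2 + 1 / 2 * ∫ ω, Real.exp (X ω ^ 2 / (ν : ℝ) ^ 2) ∂P) := by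
          rw [integral_const_mul, integral_add (integrable_const _) (hi.const_mul _),
            integral_const_mul]
          simp
      _ ≤ Real.exp ((t * ν) ^ 2 / 2) * Real.exp ((t * ν) ^ 2 / 2) := by
          apply mul_le_mul_of_nonneg_left _ (Real.exp_pos _).le
          have := Real.add_one_le_exp ((t * ν) ^ 2 / 2)
          linarith
      _ = _ := by rw [← Real.exp_add]; ring_nf

lemma subG_mono {X : Ω → ℝ} {c c' : ℝ≥0} (h : HasSubgaussianMGF X c P) (hc : c ≤ c') :
    HasSubgaussianMGF X c' P :=
  ⟨h.integrable_exp_mul, fun t => (h.mgf_le t).trans <| Real.exp_le_exp.2 <| by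
    have : (c : ℝ) ≤ c' := hc
    gcongr⟩

lemma subG_sum [IsProbabilityMeasure P] {ι : Type*} (s : Finset ι) (Y : ι → Ω → ℝ) (c : ι → ℝ≥0)
    (h : ∀ i ∈ s, HasSubgaussianMGF (Y i) (c i) P) :
    HasSubgaussianMGF (fun ω => ∑ i ∈ s, Y i ω) ((∑ i ∈ s, (c i).sqrt) ^ 2) P := by
  classical
  induction s using Finset.induction_on with
  | empty => simp
  | insert i s his ih =>
    simp_rw [Finset.sum_insert his]
    have := (h i (Finset.mem_insert_self _ _)).add
      (ih fun j hj => h j (Finset.mem_insert_of_mem hj))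
    simpa using this

lemma lintegral_gauss {c : ℝ≥0} (hc : 0 < c) :
    ∫⁻ g, ENNReal.ofReal (Real.exp (c * g ^ 2 / 2)) ∂(gaussianReal 0 (1 / (4 * c))) ≤ 2 := by
  have hc' : (0 : ℝ) < c := hc
  have hv : (1 / (4 * c) : ℝ≥0) ≠ 0 := by positivity
  rw [gaussianReal_of_var_ne_zero _ hv, lintegral_withDensity_eq_lintegral_mul _
    (measurable_gaussianPDF _ _) (by fun_prop)]
  have e : ∀ g : ℝ, (gaussianPDF 0 (1 / (4 * c)) * fun g : ℝ => ENNReal.ofReal (Real.exp (c * g ^ 2 / 2))) g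
      = ENNReal.ofReal ((√(Real.pi / (2 * c)))⁻¹ * Real.exp (-(3 * c / 2) * g ^ 2)) := by
    intro g
    simp only [Pi.mul_apply, gaussianPDF, gaussianPDFReal]
    rw [← ENNReal.ofReal_mul (by positivity), mul_assoc, ← Real.exp_add]
    push_cast
    congr 3
    · congr 1; field_simp; norm_num
    · congr 1; field_simp; ring
  simp_rw [e]
  have hb : (0 : ℝ) < 3 * c / 2 := by positivity
  rw [← ofReal_integral_eq_lintegral_ofReal ((integrable_exp_neg_mul_sq hb).const_mul _)
    (ae_of_all _ fun g => by positivity), integral_const_mul, integral_gaussian]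
  rw [show (2 : ℝ≥0∞) = ENNReal.ofReal 2 by simp]
  apply ENNReal.ofReal_le_ofReal
  have h1 : 0 < √(Real.pi / (2 * c)) := by positivity
  rw [inv_mul_le_iff₀ h1, Real.sqrt_le_left (by positivity), mul_pow,
    Real.sq_sqrt (by positivity)]
  have := Real.pi_pos
  field_simp
  norm_num

lemma psi_of_subG [IsProbabilityMeasure P] {Y : Ω → ℝ} (hY : Measurable Y) {c : ℝ≥0} (hc : 0 < c)
    (h : HasSubgaussianMGF Y c P) :
    ∫⁻ ω, ENNReal.ofReal (Real.exp (Y ω ^ 2 / (8 * c))) ∂P ≤ 2 := by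
  have hc' : (0 : ℝ) < c := hc
  have e : ∀ ω, ENNReal.ofReal (Real.exp (Y ω ^ 2 / (8 * c))) =
      ∫⁻ g, ENNReal.ofReal (Real.exp (Y ω * g)) ∂(gaussianReal 0 (1 / (4 * c))) := by
    intro ω
    rw [← ofReal_integral_eq_lintegral_ofReal (integrable_exp_mul_gaussianReal _)
      (ae_of_all _ fun g => (Real.exp_pos _).le)]
    have := congrFun (mgf_fun_id_gaussianReal (μ := 0) (v := 1 / (4 * c))) (Y ω)
    rw [mgf] at this
    rw [this]
    congr 2
    push_cast
    field_simp
    ring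
  simp_rw [e]
  rw [lintegral_lintegral_swap (by fun_prop)]
  refine le_trans (lintegral_mono fun g => ?_) (lintegral_gauss hc)
  have h1 := h.mgf_le g
  have h2 := h.integrable_exp_mul g
  simp_rw [mul_comm (Y _) g]
  rw [← ofReal_integral_eq_lintegral_ofReal h2 (ae_of_all _ fun g => (Real.exp_pos _).le)]
  exact ENNReal.ofReal_le_ofReal h1

lemma card_class {n : ℕ} (N : ℕ) (hN : 1 ≤ N) (c : ℝ≥0) :
    (∑ r ∈ Finset.range N,
      (∑ _i : (Finset.univ.filter (fun i : Fin n => (i : ℕ) % N = r)), c).sqrt) ^ 2 ≤ n * N * c := by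
  refine (sq_sum_le_card_mul_sum_sq (s := Finset.range N)).trans ?_
  simp only [NNReal.sq_sqrt, Finset.sum_const, Finset.card_univ, Fintype.card_coe, Finset.card_range,
    nsmul_eq_mul]
  rw [← Finset.sum_mul, ← Nat.cast_sum, ← Finset.card_eq_sum_card_fiberwise]
  · simp only [Finset.card_univ, Fintype.card_fin]
    apply le_of_eq; ring
  · intro i _
    simpa using Nat.mod_lt _ hN

lemma coord_subG [IsProbabilityMeasure P] {n N : ℕ} (hN : 1 ≤ N) {c : ℝ≥0} (Y : Fin n → Ω → ℝ)
    (hY : ∀ i, HasSubgaussianMGF (Y i) c P)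
    (hind : ∀ S : Finset (Fin n),
          (∀ i ∈ S, ∀ j ∈ S, i ≠ j → (N : ℤ) ≤ |(i : ℤ) - (j : ℤ)|) →
          iIndepFun (fun i : S => Y i) P) :
    HasSubgaussianMGF (fun ω => ∑ i, Y i ω) (n * N * c) P := by
  have key := subG_sum (Finset.range N) (P := P)
    (fun r ω => ∑ i : (Finset.univ.filter (fun i : Fin n => (i : ℕ) % N = r)), Y i ω)
    (fun r => ∑ _i : (Finset.univ.filter (fun i : Fin n => (i : ℕ) % N = r)), c) ?_
  · refine (subG_mono key (card_class N hN c)).congr (ae_of_all _ fun ω => ?_)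
    simp only
    rw [← Finset.sum_fiberwise_of_maps_to (s := Finset.univ) (t := Finset.range N)
      (g := fun i : Fin n => (i : ℕ) % N) (f := fun i => Y i ω)]
    · refine Finset.sum_congr rfl fun r _ => ?_
      exact Finset.sum_coe_sort _ (fun i => Y i ω)
    · intro i _
      simpa using Nat.mod_lt _ hN
  · intro r _
    refine HasSubgaussianMGF.sum_of_iIndepFun (hind _ ?_) fun i _ => hY i
    intro i hi j hj hij
    simp only [Finset.mem_filter, Finset.mem_univ, true_and] at hi hj
    have hd : (N : ℤ) ∣ (i : ℤ) - j := by
      have : (j : ℕ) ≡ i [MOD N] := by rw [Nat.ModEq, hi, hj]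
      exact (Nat.modEq_iff_dvd.1 this)
    have hne : (i : ℤ) - j ≠ 0 := by
      intro h; apply hij; ext; omega
    exact Int.le_of_dvd (abs_pos.2 hne) ((dvd_abs _ _).2 hd)

lemma exp_sum_le {d : ℕ} (hd : 1 ≤ d) (a : Fin d → ℝ) :
    Real.exp (∑ j, a j) ≤ ∑ j, (d : ℝ)⁻¹ * Real.exp (d * a j) := by
  have hd' : (d : ℝ) ≠ 0 := by positivity
  have := convexOn_exp.map_sum_le (t := Finset.univ) (w := fun _ : Fin d => (d : ℝ)⁻¹)
    (p := fun j => d * a j) (fun _ _ => by positivity) (by simp [hd']) (fun _ _ => Set.mem_univ _)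
  simpa [hd'] using this

lemma psi_bound {d n : ℕ} {ν t : ℝ} (hν : 0 ≤ ν) (ht : ν < t) {X : Ω → (Fin d → ℝ)}
    (h : psi2 P euclNorm X ≤ ENNReal.ofReal ν) (j : Fin d) :
    ∫⁻ ω, ENNReal.ofReal (Real.exp (X ω j ^ 2 / t ^ 2)) ∂P ≤ 2 := by
  have h1 : psi2 P euclNorm X < ENNReal.ofReal t :=
    h.trans_lt ((ENNReal.ofReal_lt_ofReal_iff (by linarith)).2 ht)
  obtain ⟨s, ⟨hs0, hs⟩, hst⟩ := sInf_lt_iff.1 h1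
  have hs' : 0 < s.toReal := ENNReal.toReal_pos hs0.ne' hst.ne_top
  have hst' : s.toReal ≤ t := ENNReal.toReal_le_of_le_ofReal (by linarith) hst.le
  refine le_trans (lintegral_mono fun ω => ?_) hs
  apply ENNReal.ofReal_le_ofReal
  apply Real.exp_le_exp.2
  have : X ω j ^ 2 ≤ euclNorm (X ω) ^ 2 := by
    rw [euclNorm, Real.sq_sqrt (Finset.sum_nonneg fun _ _ => sq_nonneg _)]
    exact Finset.single_le_sum (f := fun j => X ω j ^ 2) (fun _ _ => sq_nonneg _) (Finset.mem_univ j)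
  gcongr

end LocalDep


/-- **Local dependence bound.** For each dimension `d ≥ 1` there is a constant `C > 0`
(depending only on `d`) such that: if `X₁, …, Xₙ` are mean-zero random vectors in `ℝ^d`
with `‖Xᵢ‖_{ψ₂} ≤ ν`, and every subfamily of indices with pairwise distances `≥ N` is
jointly independent, then `‖Σᵢ Xᵢ‖_{ψ₂} ≤ C √(nN) ν`. -/
theorem local_dependence_psi2 (d : ℕ) (hd : 1 ≤ d) :
    ∃ C > (0 : ℝ),
      ∀ (n N : ℕ) (hn : 1 ≤ n) (hN : 1 ≤ N) (ν : ℝ) (hν : 0 ≤ ν)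
        (Ω : Type) (_ : MeasurableSpace Ω) (P : Measure Ω) (_ : IsProbabilityMeasure P)
        (X : Fin n → Ω → (Fin d → ℝ)),
        (∀ i, Measurable (X i)) →
        (∀ i, (∫ ω, X i ω ∂P) = 0) →
        (∀ i, psi2 P euclNorm (X i) ≤ ENNReal.ofReal ν) →
        (∀ S : Finset (Fin n),
          (∀ i ∈ S, ∀ j ∈ S, i ≠ j → (N : ℤ) ≤ |(i : ℤ) - (j : ℤ)|) →
          iIndepFun (fun i : S => X i) P) →
        psi2 P euclNorm (fun ω => ∑ i, X i ω)
          ≤ ENNReal.ofReal (C * Real.sqrt ((n : ℝ) * N) * ν) := by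
  have hd' : (0 : ℝ) < d := by exact_mod_cast hd
  refine ⟨4 * √d, by positivity, ?_⟩
  intro n N hn hN ν hν Ω _ P _ X hXm hX0 hXp hind
  have hn' : (0 : ℝ) < n := by exact_mod_cast hn
  have hN' : (0 : ℝ) < N := by exact_mod_cast hN
  have main : ∀ t : ℝ, ν < t → psi2 P euclNorm (fun ω => ∑ i, X i ω)
      ≤ ENNReal.ofReal (4 * √d * √(n * N) * t) := by
    intro t ht
    have ht0 : 0 < t := by linarith
    lift t to NNReal using ht0.le
    have ht0' : 0 < t := by exact_mod_cast ht0
    have hb := fun i j => LocalDep.psi_bound (n := n) hν ht (hXp i) j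
    have hXc : ∀ i j, Measurable (fun ω => X i ω j) := fun i j => (measurable_pi_apply j).comp (hXm i)
    have hsub : ∀ i j, HasSubgaussianMGF (fun ω => X i ω j) (2 * t ^ 2) P := by
      intro i j
      refine LocalDep.subG_of_psi (hXc i j) ht0' ?_ (hb i j)
      rw [← eval_integral (fun j => LocalDep.integrable_of_psi (hXc i j) ht0 (hb i j)) j, hX0 i]
      rfl
    have hc : 0 < (n * N * (2 * t ^ 2) : NNReal) := by
      have : 0 < (n * N : NNReal) := by exact_mod_cast Nat.mul_pos hn hN
      positivity
    have hcs : ∀ j, ∫⁻ ω, ENNReal.ofReal (Real.exp ((∑ i, X i ω j) ^ 2 /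
        (8 * ((n * N * (2 * t ^ 2) : NNReal) : ℝ)))) ∂P ≤ 2 := by
      intro j
      refine LocalDep.psi_of_subG (Finset.measurable_sum _ fun i _ => hXc i j) hc ?_
      refine LocalDep.coord_subG hN (fun i ω => X i ω j) (fun i => hsub i j) fun S hS => ?_
      exact (hind S hS).comp (fun _ v => v j) fun _ => measurable_pi_apply j
    have hT : 0 < 4 * √d * √(n * N) * (t : ℝ) := by positivity
    refine sInf_le ⟨ENNReal.ofReal_pos.2 hT, ?_⟩
    rw [ENNReal.toReal_ofReal hT.le]
    calc ∫⁻ ω, ENNReal.ofReal (Real.exp (euclNorm (∑ i, X i ω) ^ 2 /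
          (4 * √d * √(n * N) * (t : ℝ)) ^ 2)) ∂P
        ≤ ∫⁻ ω, ∑ j, ENNReal.ofReal (d : ℝ)⁻¹ * ENNReal.ofReal (Real.exp ((∑ i, X i ω j) ^ 2 /
        (8 * ((n * N * (2 * t ^ 2) : NNReal) : ℝ)))) ∂P := by
          refine lintegral_mono fun ω => ?_
          simp_rw [← ENNReal.ofReal_mul (inv_nonneg.2 hd'.le)]
          rw [← ENNReal.ofReal_sum_of_nonneg fun j _ => by positivity]
          apply ENNReal.ofReal_le_ofReal
          have := LocalDep.exp_sum_le hd (fun j => (∑ i, X i ω j) ^ 2 /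
            (4 * √d * √(n * N) * (t : ℝ)) ^ 2)
          rw [euclNorm, Real.sq_sqrt (Finset.sum_nonneg fun _ _ => sq_nonneg _), Finset.sum_div]
          simp only [Finset.sum_apply]
          refine this.trans (le_of_eq ?_)
          refine Finset.sum_congr rfl fun j _ => ?_
          congr 2
          simp only [mul_pow]
          rw [Real.sq_sqrt hd'.le, Real.sq_sqrt (by positivity)]
          push_cast
          field_simp
          ring
      _ = ∑ j, ENNReal.ofReal (d : ℝ)⁻¹ * ∫⁻ ω, ENNReal.ofReal (Real.exp ((∑ i, X i ω j) ^ 2 /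
        (8 * ((n * N * (2 * t ^ 2) : NNReal) : ℝ)))) ∂P := by
          rw [lintegral_finsetSum _ (fun j _ => by fun_prop)]
          refine Finset.sum_congr rfl fun j _ => ?_
          rw [lintegral_const_mul _ (by fun_prop)]
      _ ≤ ∑ _j : Fin d, ENNReal.ofReal (d : ℝ)⁻¹ * 2 := by
          gcongr with j
          exact hcs j
      _ = 2 := by
          rw [Finset.sum_const, Finset.card_univ, Fintype.card_fin, nsmul_eq_mul, ← mul_assoc,
            ENNReal.ofReal_inv_of_pos hd', ENNReal.ofReal_natCast,
            ENNReal.mul_inv_cancel (by exact_mod_cast hd'.ne') (by simp), one_mul]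
  have hcont : Filter.Tendsto (fun t : ℝ => ENNReal.ofReal (4 * √d * √(n * N) * t))
      (nhdsWithin ν (Set.Ioi ν)) (nhds (ENNReal.ofReal (4 * √d * √(n * N) * ν))) := by
    refine Filter.Tendsto.mono_left ?_ nhdsWithin_le_nhds
    refine (ENNReal.continuous_ofReal.comp ?_).tendsto ν
    fun_prop
  refine ge_of_tendsto hcont ?_
  filter_upwards [self_mem_nhdsWithin] with t ht
  exact main t ht
end

section
/- Let n ≥ 1, σ > 0, and μ₁, …, μₙ ∈ ℝ, and set η = (1/n) Σ_{i=1}^n μ_i². For β ∈ {A, B} and i ∈ {1, …, n}, let X_{β,i} = μ_i + ε_{β,i}, where the 2n random variables ε_{β,i} are jointly independent and each has the Gaussian distribution N(0, σ²). Define η̂₁ = (1/(2n)) ( Σ_{i=1}^n X_{A,i}² + Σ_{i=1}^n X_{B,i}² ) and η̂₂ = (1/n) Σ_{i=1}^n X_{A,i} X_{B,i}. Then E[η̂₁] = η + σ², E[η̂₂] = η, and Var(η̂₁) = Var(η̂₂) = (2σ²η + σ⁴)/n. In particular η̂₂ is unbiased and has strictly smaller mean squared error than η̂₁: E[(η̂₂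 − η)²] < E[(η̂₁ − η)²]. -/
open MeasureTheory ProbabilityTheory

lemma aux_moment_deriv (m v : ℝ) (p q : ℝ → ℝ)
    (h : ∀ t, HasDerivAt p (q t - (m + v * t) * p t) t) :
    deriv (fun t => p t * Real.exp (m * t + v * t ^ 2 / 2))
      = fun t => q t * Real.exp (m * t + v * t ^ 2 / 2) := by
  ext t
  have h2 : HasDerivAt (fun t : ℝ => m * t + v * t ^ 2 / 2) (m + v * t) t := by
    have := ((hasDerivAt_id t).const_mul m).add
      ((((hasDerivAt_id t).pow 2).const_mul v).div_const 2)
    refine this.congr_deriv ?_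
    simp
    ring
  have := (h t).mul h2.exp
  refine HasDerivAt.deriv (this.congr_deriv ?_)
  ring

lemma aux_deriv_lin (m v t : ℝ) : HasDerivAt (fun t : ℝ => m + v * t) v t := by
  simpa using ((hasDerivAt_id t).const_mul v).const_add m

lemma aux_iter (m v : ℝ) :
    iteratedDeriv 2 (fun t => Real.exp (m * t + v * t ^ 2 / 2)) 0 = m ^ 2 + v ∧
    iteratedDeriv 4 (fun t => Real.exp (m * t + v * t ^ 2 / 2)) 0
      = m ^ 4 + 6 * m ^ 2 * v + 3 * v ^ 2 := by
  have e0 : (fun t => Real.exp (m * t + v * t ^ 2 / 2))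
      = fun t => (fun _ : ℝ => (1 : ℝ)) t * Real.exp (m * t + v * t ^ 2 / 2) := by simp
  have d1 := aux_moment_deriv m v (fun _ => 1) (fun t => m + v * t) (fun t =>
    (hasDerivAt_const t (1 : ℝ)).congr_deriv (by ring))
  have d2 := aux_moment_deriv m v (fun t => m + v * t) (fun t => (m + v * t) ^ 2 + v) (fun t =>
    (aux_deriv_lin m v t).congr_deriv (by ring))
  have d3 := aux_moment_deriv m v (fun t => (m + v * t) ^ 2 + v)
    (fun t => (m + v * t) ^ 3 + 3 * v * (m + v * t)) (fun t =>
    (((aux_deriv_lin m v t).pow 2).add_const v).congr_deriv (by simp; ring))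
  have d4 := aux_moment_deriv m v (fun t => (m + v * t) ^ 3 + 3 * v * (m + v * t))
    (fun t => (m + v * t) ^ 4 + 6 * v * (m + v * t) ^ 2 + 3 * v ^ 2) (fun t =>
    (((aux_deriv_lin m v t).pow 3).add ((aux_deriv_lin m v t).const_mul (3 * v))).congr_deriv
      (by simp; ring))
  rw [e0]
  constructor
  · rw [iteratedDeriv_succ, iteratedDeriv_one, d1, d2]; simp
  · rw [iteratedDeriv_succ, iteratedDeriv_succ, iteratedDeriv_succ, iteratedDeriv_one,
      d1, d2, d3, d4]
    simp; ring

lemma aux_gauss {Ω : Type*} [MeasurableSpace Ω] (P : Measure Ω) [IsProbabilityMeasure P]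
    (X : Ω → ℝ) (hX : Measurable X) (m : ℝ) (v : NNReal) (h : P.map X = gaussianReal m v) :
    (∫ ω, X ω ∂P = m) ∧ (∫ ω, X ω ^ 2 ∂P = m ^ 2 + v) ∧
    (∫ ω, X ω ^ 4 ∂P = m ^ 4 + 6 * m ^ 2 * v + 3 * (v : ℝ) ^ 2) ∧
    MemLp X 4 P ∧ MemLp (fun ω => X ω ^ 2) 2 P := by
  have key : ∀ k : ℕ, ∫ ω, X ω ^ k ∂P
      = iteratedDeriv k (fun t => Real.exp (m * t + v * t ^ 2 / 2)) 0 := by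
    intro k
    have : ∫ ω, X ω ^ k ∂P = ∫ x, x ^ k ∂(P.map X) := by
      rw [integral_map hX.aemeasurable (by fun_prop)]
    rw [this, h, ← mgf_fun_id_gaussianReal, iteratedDeriv_mgf_zero (by simp)]
    simp
  have h4 : MemLp X 4 P := by
    have := memLp_id_gaussianReal' (μ := m) (v := v) 4 (by simp)
    rw [← h] at this
    exact (memLp_map_measure_iff (by fun_prop) hX.aemeasurable).1 this
  refine ⟨?_, ?_, ?_, h4, ?_⟩
  · have : ∫ ω, X ω ∂P = ∫ x, x ∂(P.map X) := by
      rw [integral_map hX.aemeasurable (by fun_prop)]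
    rw [this, h, integral_id_gaussianReal]
  · rw [key, (aux_iter m v).1]
  · rw [key, (aux_iter m v).2]
  · rw [memLp_two_iff_integrable_sq (by fun_prop)]
    have := h4.integrable_norm_pow (p := 4) (by norm_num)
    refine this.congr (Filter.Eventually.of_forall fun ω => ?_)
    have : |X ω| ^ 4 = X ω ^ 4 := (by decide : Even 4).pow_abs _
    simp only [Real.norm_eq_abs, this]
    ring

lemma aux_mse {Ω : Type*} [MeasurableSpace Ω] (P : Measure Ω) [IsProbabilityMeasure P]
    (X : Ω → ℝ) (hX : MemLp X 2 P) (c : ℝ) :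
    ∫ ω, (X ω - c) ^ 2 ∂P = variance X P + (∫ ω, X ω ∂P - c) ^ 2 := by
  have h1 := variance_sub_const hX.1 c
  have h2 := variance_eq_sub (hX.sub (memLp_const c))
  have h3 : ∫ ω, (X ω - c) ∂P = ∫ ω, X ω ∂P - c := by
    rw [integral_sub (hX.integrable (by norm_num)) (integrable_const _)]; simp
  rw [← h1, ← h3]
  change variance (fun ω => X ω - c) P = ∫ ω, (X ω - c) ^ 2 ∂P - (∫ ω, (X ω - c) ∂P) ^ 2 at h2
  linarith

/-- **Miniature comparison of the least-squares and IV quadratic terms.** Let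
`X_{β,i} = μ_i + ε_{β,i}`, with the `2n` noises `ε_{β,i}` jointly independent `N(0, σ²)`
Gaussians, and set `η = (1/n) Σ μ_i²`. Then the estimators
`η̂₁ = (1/(2n))(Σ X_{A,i}² + Σ X_{B,i}²)` and `η̂₂ = (1/n) Σ X_{A,i} X_{B,i}` satisfy
`E[η̂₁] = η + σ²`, `E[η̂₂] = η`, `Var(η̂₁) = Var(η̂₂) = (2σ²η + σ⁴)/n`; in particular
`η̂₂` is unbiased and has strictly smaller mean squared error than `η̂₁`. -/
theorem iv_vs_ls_one_dimensional
    (n : ℕ) (hn : 1 ≤ n) (σ : ℝ) (hσ : 0 < σ) (μ : Fin n → ℝ)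
    {Ω : Type*} [MeasurableSpace Ω] (P : Measure Ω) [IsProbabilityMeasure P]
    (ε : Bool → Fin n → Ω → ℝ)
    (hmeas : ∀ b i, Measurable (ε b i))
    (hind : iIndepFun
      (fun bi : Bool × Fin n => ε bi.1 bi.2) P)
    (hlaw : ∀ b i, Measure.map (ε b i) P = gaussianReal 0 (Real.toNNReal (σ ^ 2))) :
    -- `β = A` is encoded as `true`, `β = B` as `false`;
    -- `X_{β,i} ω = μ i + ε β i ω`, `η = (1/n) Σ μ_i²`.
    (∫ ω, (1 / (2 * (n : ℝ)))
        * ((∑ i, (μ i + ε true i ω) ^ 2) + ∑ i, (μ i + ε false i ω) ^ 2) ∂P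
      = (1 / (n : ℝ)) * ∑ i, μ i ^ 2 + σ ^ 2)
    ∧ (∫ ω, (1 / (n : ℝ)) * ∑ i, (μ i + ε true i ω) * (μ i + ε false i ω) ∂P
      = (1 / (n : ℝ)) * ∑ i, μ i ^ 2)
    ∧ (variance (fun ω => (1 / (2 * (n : ℝ)))
          * ((∑ i, (μ i + ε true i ω) ^ 2) + ∑ i, (μ i + ε false i ω) ^ 2)) P
        = (2 * σ ^ 2 * ((1 / (n : ℝ)) * ∑ i, μ i ^ 2) + σ ^ 4) / n)
    ∧ (variance (fun ω => (1 / (n : ℝ))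
          * ∑ i, (μ i + ε true i ω) * (μ i + ε false i ω)) P
        = (2 * σ ^ 2 * ((1 / (n : ℝ)) * ∑ i, μ i ^ 2) + σ ^ 4) / n)
    ∧ (∫ ω, ((1 / (n : ℝ)) * (∑ i, (μ i + ε true i ω) * (μ i + ε false i ω))
          - (1 / (n : ℝ)) * ∑ i, μ i ^ 2) ^ 2 ∂P
        < ∫ ω, ((1 / (2 * (n : ℝ)))
            * ((∑ i, (μ i + ε true i ω) ^ 2) + ∑ i, (μ i + ε false i ω) ^ 2)
          - (1 / (n : ℝ)) * ∑ i, μ i ^ 2) ^ 2 ∂P) := by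
  have hn0 : (n : ℝ) ≠ 0 := by positivity
  set v := Real.toNNReal (σ ^ 2) with hv
  have hvσ : (v : ℝ) = σ ^ 2 := Real.coe_toNNReal _ (by positivity)
  let X : Bool × Fin n → Ω → ℝ := fun p ω => μ p.2 + ε p.1 p.2 ω
  have hXm : ∀ p, Measurable (X p) := fun p => (hmeas p.1 p.2).const_add _
  have hXi : iIndepFun X P :=
    hind.comp (fun p x => μ p.2 + x) (fun p => measurable_const_add _)
  have hXl : ∀ p, P.map (X p) = gaussianReal (μ p.2) v := by
    intro p
    have : X p = (fun x => μ p.2 + x) ∘ ε p.1 p.2 := rfl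
    rw [this, ← Measure.map_map (measurable_const_add _) (hmeas _ _), hlaw,
      gaussianReal_map_const_add, zero_add]
  have hG := fun p => aux_gauss P (X p) (hXm p) _ _ (hXl p)
  have hS : ∀ p, MemLp (fun ω => X p ω ^ 2) 2 P := fun p => (hG p).2.2.2.2
  have hSv : ∀ p, variance (fun ω => X p ω ^ 2) P = 4 * μ p.2 ^ 2 * σ ^ 2 + 2 * σ ^ 4 := by
    intro p
    rw [variance_eq_sub (hS p)]
    have : ∫ ω, ((fun ω => X p ω ^ 2) ^ 2) ω ∂P = ∫ ω, X p ω ^ 4 ∂P := by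
      congr 1; ext ω; simp only [Pi.pow_apply]; ring
    rw [this, (hG p).2.1, (hG p).2.2.1, hvσ]; ring
  have hab : ∀ i, IndepFun (X (true, i)) (X (false, i)) P := fun i => hXi.indepFun (by simp)
  -- products
  have hPm : ∀ i, MemLp (fun ω => X (true, i) ω * X (false, i) ω) 2 P := by
    intro i
    refine (memLp_two_iff_integrable_sq
      ((hXm (true, i)).mul (hXm (false, i))).aestronglyMeasurable).2 ?_
    have := ((hS (true, i)).integrable_mul (hS (false, i)))
    refine this.congr (Filter.Eventually.of_forall fun ω => ?_)
    simp only [Pi.mul_apply]; ring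
  have hPe : ∀ i, ∫ ω, X (true, i) ω * X (false, i) ω ∂P = μ i ^ 2 := by
    intro i
    rw [(hab i).integral_fun_mul_eq_mul_integral (hXm _).aestronglyMeasurable
      (hXm _).aestronglyMeasurable, (hG _).1, (hG _).1]
    ring
  have hPv : ∀ i, variance (fun ω => X (true, i) ω * X (false, i) ω) P
      = 2 * μ i ^ 2 * σ ^ 2 + σ ^ 4 := by
    intro i
    rw [variance_eq_sub (hPm i), hPe]
    have : ∫ ω, ((fun ω => X (true, i) ω * X (false, i) ω) ^ 2) ω ∂P
        = ∫ ω, X (true, i) ω ^ 2 * X (false, i) ω ^ 2 ∂P := by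
      congr 1; ext ω; simp only [Pi.pow_apply]; ring
    rw [this, (hab i).integral_fun_comp_mul_comp (f := fun x => x ^ 2) (g := fun x => x ^ 2)
      (hXm _).aemeasurable (hXm _).aemeasurable (by fun_prop) (by fun_prop),
      (hG _).2.1, (hG _).2.1, hvσ]
    ring
  -- rewriting the estimators
  have e1 : (fun ω => (1 / (2 * (n : ℝ)))
        * ((∑ i, (μ i + ε true i ω) ^ 2) + ∑ i, (μ i + ε false i ω) ^ 2))
      = fun ω => (1 / (2 * (n : ℝ))) * (∑ p, fun ω => X p ω ^ 2) ω := by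
    ext ω
    simp [Finset.sum_apply, Fintype.sum_prod_type, X]
  have e2 : (fun ω => (1 / (n : ℝ)) * ∑ i, (μ i + ε true i ω) * (μ i + ε false i ω))
      = fun ω => (1 / (n : ℝ)) * (∑ i, fun ω => X (true, i) ω * X (false, i) ω) ω := by
    ext ω
    simp [Finset.sum_apply, X]
  have m1 : MemLp (fun ω => (1 / (2 * (n : ℝ)))
        * ((∑ i, (μ i + ε true i ω) ^ 2) + ∑ i, (μ i + ε false i ω) ^ 2)) 2 P := by
    rw [e1]
    exact (memLp_finsetSum' _ fun p _ => hS p).const_mul _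
  have m2 : MemLp (fun ω => (1 / (n : ℝ))
        * ∑ i, (μ i + ε true i ω) * (μ i + ε false i ω)) 2 P := by
    rw [e2]
    exact (memLp_finsetSum' _ fun i _ => hPm i).const_mul _
  have E1 : ∫ ω, (1 / (2 * (n : ℝ)))
        * ((∑ i, (μ i + ε true i ω) ^ 2) + ∑ i, (μ i + ε false i ω) ^ 2) ∂P
      = (1 / (n : ℝ)) * ∑ i, μ i ^ 2 + σ ^ 2 := by
    rw [e1, integral_const_mul]
    simp only [Finset.sum_apply]
    rw [integral_finsetSum _ fun p _ => (hS p).integrable (by norm_num)]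
    simp only [(hG _).2.1, hvσ, Fintype.sum_prod_type, Fintype.card_bool, Fintype.card_prod,
      Nat.cast_mul, Nat.cast_ofNat, Finset.sum_add_distrib,
      Finset.sum_const, Finset.card_univ, Fintype.card_fin, nsmul_eq_mul]
    field_simp
  have E2 : ∫ ω, (1 / (n : ℝ)) * ∑ i, (μ i + ε true i ω) * (μ i + ε false i ω) ∂P
      = (1 / (n : ℝ)) * ∑ i, μ i ^ 2 := by
    rw [e2, integral_const_mul]
    simp only [Finset.sum_apply]
    rw [integral_finsetSum _ fun p _ => (hPm p).integrable (by norm_num)]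
    simp only [hPe]
  have V1 : variance (fun ω => (1 / (2 * (n : ℝ)))
          * ((∑ i, (μ i + ε true i ω) ^ 2) + ∑ i, (μ i + ε false i ω) ^ 2)) P
        = (2 * σ ^ 2 * ((1 / (n : ℝ)) * ∑ i, μ i ^ 2) + σ ^ 4) / n := by
    rw [e1, variance_const_mul, IndepFun.variance_sum (fun p _ => hS p)]
    · simp only [hSv, Fintype.sum_prod_type, Fintype.card_bool, Fintype.card_prod,
      Nat.cast_mul, Nat.cast_ofNat, Finset.sum_add_distrib,
        Finset.sum_const, Finset.card_univ, Fintype.card_fin, nsmul_eq_mul, ← Finset.sum_mul,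
        ← Finset.mul_sum]
      field_simp
      ring
    · intro p _ q _ hpq
      exact (hXi.indepFun hpq).comp (φ := fun x => x ^ 2) (ψ := fun x => x ^ 2)
        (by fun_prop) (by fun_prop)
  have V2 : variance (fun ω => (1 / (n : ℝ))
          * ∑ i, (μ i + ε true i ω) * (μ i + ε false i ω)) P
        = (2 * σ ^ 2 * ((1 / (n : ℝ)) * ∑ i, μ i ^ 2) + σ ^ 4) / n := by
    rw [e2, variance_const_mul, IndepFun.variance_sum (fun p _ => hPm p)]
    · simp only [hPv, Finset.sum_add_distrib,
        Finset.sum_const, Finset.card_univ, Fintype.card_fin, nsmul_eq_mul, ← Finset.sum_mul,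
        ← Finset.mul_sum]
      field_simp
    · intro i _ j _ hij
      exact hXi.indepFun_mul_mul hXm (true, i) (false, i) (true, j) (false, j)
        (by simp [hij]) (by simp) (by simp) (by simp [hij])
  refine ⟨E1, E2, V1, V2, ?_⟩
  rw [aux_mse P _ m1, aux_mse P _ m2, E1, E2, V1, V2]
  have : 0 < (σ ^ 2) ^ 2 := by positivity
  simpa using this
end
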